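/- Let A be a real symmetric N×N matrix such that both A and I − A are positive semidefinite (all eigenvalues of A lie in [0,1]). For α ∈ (0,1), the matrix I − α·A is invertible; define H(α) = (1−α)·(I − α·A)⁻¹. Then for all α_1, α_2 with 0 < α_1 ≤ α_2 < 1 and every real symmetric positive semidefinite N×N matrix Σ, Tr(H(α_2)·Σ·H(α_2)ᵀ) ≤ Tr(H(α_1)·Σ·H(α_1)ᵀ). -/

import Mathlib

open Matrix

/-- The trace of a product of two positive semidefinite real matrices is nonnegative. -/
theorem Matrix.PosSemidef.trace_mul_nonneg_of_real {n : Type*} [Fintype n] [DecidableEq n]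
    {P Q : Matrix n n ℝ} (hP : P.PosSemidef) (hQ : Q.PosSemidef) : 0 ≤ (P * Q).trace := by
  obtain ⟨B, rfl⟩ : ∃ B : Matrix n n ℝ, Q = Bᴴ * B := by
    open scoped MatrixOrder in
    exact CStarAlgebra.nonneg_iff_eq_star_mul_self.mp hQ.nonneg
  rw [← Matrix.mul_assoc, Matrix.trace_mul_comm, ← Matrix.mul_assoc]
  exact (hP.mul_mul_conjTranspose_same B).trace_nonneg

/-- If `1 - A` is positive semidefinite and `0 ≤ α < 1`, then `1 - α • A` is positive definite. -/
theorem Matrix.PosSemidef.posDef_one_sub_smul {n : Type*} [Fintype n] [DecidableEq n]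
    {A : Matrix n n ℝ} (hIA : (1 - A).PosSemidef) {α : ℝ} (h₀ : 0 ≤ α) (h₁ : α < 1) :
    (1 - α • A).PosDef := by
  have h : 1 - α • A = (1 - α) • (1 : Matrix n n ℝ) + α • (1 - A) := by module
  rw [h]
  exact (PosDef.one.smul (sub_pos.mpr h₁)).add_posSemidef (hIA.smul h₀)

/-- The matrices `((1 - α) • (1 - α • A)⁻¹) ^ 2` decrease in the Loewner order as `α` increases. -/
theorem Matrix.PosSemidef.sq_resolvent_sub {n : Type*} [Fintype n] [DecidableEq n]
    {A : Matrix n n ℝ} (hIA : (1 - A).PosSemidef) {a b : ℝ} (ha : 0 ≤ a) (hab : a ≤ b)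
    (hb : b < 1) :
    (((1 - a) • (1 - a • A)⁻¹) * ((1 - a) • (1 - a • A)⁻¹) -
      ((1 - b) • (1 - b • A)⁻¹) * ((1 - b) • (1 - b • A)⁻¹)).PosSemidef := by
  have hM := hIA.posDef_one_sub_smul ha (hab.trans_lt hb)
  have hL := hIA.posDef_one_sub_smul (ha.trans hab) hb
  set M := 1 - a • A with hMdef
  set L := 1 - b • A with hLdef
  have hcomm : M * L = L * M := by
    simp only [hMdef, hLdef, mul_sub, sub_mul, smul_mul_assoc, mul_smul_comm, mul_one, one_mul]
    module
  have hinv : M⁻¹ * L⁻¹ = L⁻¹ * M⁻¹ := by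
    rw [← Matrix.mul_inv_rev, ← Matrix.mul_inv_rev, hcomm]
  have hMu : IsUnit M.det := (Matrix.isUnit_iff_isUnit_det M).mp hM.isUnit
  have hLu : IsUnit L.det := (Matrix.isUnit_iff_isUnit_det L).mp hL.isUnit
  have hD : ((1 - a) ^ 2 • (L * L) - (1 - b) ^ 2 • (M * M)).PosSemidef := by
    have h : (1 - a) ^ 2 • (L * L) - (1 - b) ^ 2 • (M * M) =
        (b - a) • ((2 * (1 - a) * (1 - b)) • (1 - A) +
          ((1 - a) * b + (1 - b) * a) • ((1 - A)ᴴ * (1 - A))) := by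
      rw [hIA.isHermitian.eq]
      simp only [hMdef, hLdef, mul_sub, sub_mul, smul_mul_assoc, mul_smul_comm, mul_one, one_mul]
      module
    have ha' : 0 ≤ 1 - a := by linarith
    have hb' : 0 ≤ 1 - b := by linarith
    have hb₀ : 0 ≤ b := ha.trans hab
    rw [h]
    exact ((hIA.smul (by positivity)).add
      ((posSemidef_conjTranspose_mul_self _).smul (by positivity))).smul (sub_nonneg.mpr hab)
  have hT : (M⁻¹ * L⁻¹)ᴴ = M⁻¹ * L⁻¹ := by
    rw [conjTranspose_mul, hM.isHermitian.inv.eq, hL.isHermitian.inv.eq, hinv]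
  have key := hD.conjTranspose_mul_mul_same (M⁻¹ * L⁻¹)
  rw [hT] at key
  have h₁ : M⁻¹ * L⁻¹ * (L * L) * (M⁻¹ * L⁻¹) = M⁻¹ * M⁻¹ := by
    calc _ = M⁻¹ * (L⁻¹ * L) * (L * (M⁻¹ * L⁻¹)) := by simp only [Matrix.mul_assoc]
      _ = M⁻¹ * (L⁻¹ * L) * ((L * L⁻¹) * M⁻¹) := by rw [hinv]; simp only [Matrix.mul_assoc]
      _ = _ := by rw [nonsing_inv_mul _ hLu, mul_nonsing_inv _ hLu, mul_one, one_mul]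
  have h₂ : M⁻¹ * L⁻¹ * (M * M) * (M⁻¹ * L⁻¹) = L⁻¹ * L⁻¹ := by
    calc _ = M⁻¹ * L⁻¹ * M * ((M * M⁻¹) * L⁻¹) := by simp only [Matrix.mul_assoc]
      _ = L⁻¹ * (M⁻¹ * M) * ((M * M⁻¹) * L⁻¹) := by
        rw [hinv]; simp only [Matrix.mul_assoc]
      _ = _ := by rw [nonsing_inv_mul _ hMu, mul_nonsing_inv _ hMu, mul_one, one_mul]
  rw [mul_sub, sub_mul, mul_smul_comm, mul_smul_comm, smul_mul_assoc, smul_mul_assoc, h₁, h₂]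
    at key
  rwa [smul_mul_smul_comm, smul_mul_smul_comm, ← sq (1 - a), ← sq (1 - b)]

/-- Variance half of Proposition 3: for `A` symmetric with `0 ⪯ A ⪯ I`,
`H(α) = (1−α)(I − αA)⁻¹`, and any positive semidefinite covariance matrix `S`, the variance
`Tr(H(α) S H(α)ᵀ)` is monotone decreasing in `α ∈ (0,1)`. -/
theorem stmt16 (N : ℕ) (A : Matrix (Fin N) (Fin N) ℝ) (hAsymm : A.IsSymm)
    (hA : A.PosSemidef) (hIA : ((1 : Matrix (Fin N) (Fin N) ℝ) - A).PosSemidef) :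
    (∀ α : ℝ, 0 < α → α < 1 → IsUnit (1 - α • A)) ∧
    ∀ α₁ α₂ : ℝ, 0 < α₁ → α₁ ≤ α₂ → α₂ < 1 →
      ∀ S : Matrix (Fin N) (Fin N) ℝ, S.IsSymm → S.PosSemidef →
        (((1 - α₂) • (1 - α₂ • A)⁻¹) * S * ((1 - α₂) • (1 - α₂ • A)⁻¹)ᵀ).trace ≤
          (((1 - α₁) • (1 - α₁ • A)⁻¹) * S * ((1 - α₁) • (1 - α₁ • A)⁻¹)ᵀ).trace := by
  refine ⟨fun α h₀ h₁ => (hIA.posDef_one_sub_smul h₀.le h₁).isUnit, ?_⟩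
  intro a b ha hab hb S _ hS
  have hsymm (c : ℝ) : ((1 - c) • (1 - c • A)⁻¹)ᵀ = (1 - c) • (1 - c • A)⁻¹ := by
    rw [transpose_smul, transpose_nonsing_inv, transpose_sub, transpose_smul, transpose_one,
      hAsymm.eq]
  have key := (hIA.sq_resolvent_sub ha.le hab hb).trace_mul_nonneg_of_real hS
  rw [sub_mul, trace_sub, sub_nonneg] at key
  rwa [hsymm, hsymm, trace_mul_comm (_ * S), ← Matrix.mul_assoc, trace_mul_comm (_ * S),
    ← Matrix.mul_assoc]
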